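/- Assume (H0), (H1) and (H2) hold for V with parameters D, C, s, let δ_n = n^{−α} with 0 < α ≤ 1, and let a, a' be two variation sequences with min(M(a), M(a')) > D + s/2 + 1/4; set n_a = n − L(a) + 1 and n_{a'} = n − L(a') + 1. Then the quantity Γ_n := 2 Σ_{i=1}^{n_a} Σ_{i'=1}^{n_{a'}} ( Σ_m (a*a')_m V((i−i'+m)δ_n) )², which equals the covariance Cov(V_{a,n}, V_{a',n}) of the quadratic a- and a'-variations of a centered Gaussian process with semi-variogram V, satisfies Γ_n / ( 2 n C² δ_n^{4D+2s} Σ_{i∈ℤ} R(i,1,2D,|·|^s,a*a')² ) → 1 as n → ∞. -/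

import Mathlib

open Filter MeasureTheory

/-- Convolution of finitely supported sequences: `(a*a')_m = Σ_{k-l=m} a_k a'_l`. -/
noncomputable def seqConv (a a' : ℤ → ℝ) (m : ℤ) : ℝ := ∑ᶠ k : ℤ, a k * a' (k - m)

/-- `R(i,δ,q,f,c) = −Σ_j c_j j^q ∫_0^1 ((1−η)^{q−1}/(q−1)!) f((i+jη)δ) dη` for `q ≥ 1`,
and `R(i,δ,0,f,c) = −Σ_j c_j f((i+j)δ)`. -/
noncomputable def Rq (i : ℤ) (δ : ℝ) (q : ℕ) (f : ℝ → ℝ) (c : ℤ → ℝ) : ℝ :=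
  if q = 0 then -∑ᶠ j : ℤ, c j * f ((i + j) * δ)
  else -∑ᶠ j : ℤ, c j * (j : ℝ) ^ q *
    ∫ η in (0:ℝ)..1, ((1 - η) ^ (q - 1) / (Nat.factorial (q - 1) : ℝ)) * f ((i + j * η) * δ)

/-- The averaging functional behind `Rq`: integration against the Taylor remainder kernel of
order `q`, and evaluation at `1` for `q = 0`. -/
noncomputable def remMean (q : ℕ) (φ : ℝ → ℝ) : ℝ :=
  if q = 0 then φ 1
  else ∫ η in (0:ℝ)..1, ((1 - η) ^ (q - 1) / (Nat.factorial (q - 1) : ℝ)) * φ η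

lemma Rq_eq_remMean (i : ℤ) (δ : ℝ) (q : ℕ) (f : ℝ → ℝ) (c : ℤ → ℝ) :
    Rq i δ q f c
      = -∑ᶠ j : ℤ, c j * (j : ℝ) ^ q * remMean q fun η => f ((i + j * η) * δ) := by
  unfold Rq remMean
  split_ifs with h <;> simp [h]

lemma remMean_const_mul (q : ℕ) (c : ℝ) (φ : ℝ → ℝ) :
    remMean q (fun η => c * φ η) = c * remMean q φ := by
  unfold remMean
  split_ifs
  · rfl
  · rw [← intervalIntegral.integral_const_mul]
    congr 1; ext η; ring

lemma remMean_add (q : ℕ) {φ ψ : ℝ → ℝ} (hφ : Continuous φ) (hψ : Continuous ψ) :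
    remMean q (fun η => φ η + ψ η) = remMean q φ + remMean q ψ := by
  unfold remMean
  split_ifs
  · rfl
  · rw [← intervalIntegral.integral_add]
    · congr 1; ext η; ring
    all_goals exact Continuous.intervalIntegrable (by fun_prop) _ _

lemma remMean_sum (q : ℕ) {ι : Type*} (S : Finset ι) {φ : ι → ℝ → ℝ}
    (hφ : ∀ k ∈ S, Continuous (φ k)) :
    remMean q (fun η => ∑ k ∈ S, φ k η) = ∑ k ∈ S, remMean q (φ k) := by
  classical
  induction S using Finset.induction_on with
  | empty => simp [remMean]
  | insert k S hk ih =>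
    simp only [Finset.sum_insert hk]
    rw [remMean_add q (hφ _ (by simp)) (continuous_finsetSum _ fun k' h' => hφ k' (by simp [h'])),
      ih fun k' h' => hφ k' (by simp [h'])]

lemma abs_remMean_le (q : ℕ) {φ : ℝ → ℝ} {B : ℝ} (h : ∀ η ∈ Set.Icc (0:ℝ) 1, |φ η| ≤ B) :
    |remMean q φ| ≤ B := by
  have hB : 0 ≤ B := (abs_nonneg _).trans (h 0 (by simp))
  unfold remMean
  split_ifs
  · exact h 1 (by simp)
  · have := intervalIntegral.norm_integral_le_of_norm_le_const (a := (0:ℝ)) (b := 1) (C := B)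
      (f := fun η => ((1 - η) ^ (q - 1) / (Nat.factorial (q - 1) : ℝ)) * φ η) ?_
    · simpa using this
    · intro η hη
      rw [Set.uIoc_of_le zero_le_one] at hη
      rw [norm_mul, Real.norm_eq_abs, Real.norm_eq_abs, ← one_mul B]
      refine mul_le_mul ?_ (h η ⟨hη.1.le, hη.2⟩) (abs_nonneg _) zero_le_one
      rw [abs_of_nonneg (div_nonneg (pow_nonneg (by linarith [hη.2]) _) (by positivity))]
      refine div_le_one_of_le₀ ?_ (by positivity)
      refine (pow_le_one₀ (by linarith [hη.2]) (by linarith [hη.1])).trans ?_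
      exact_mod_cast Nat.one_le_iff_ne_zero.2 (Nat.factorial_ne_zero _)

/-- Taylor's formula with the remainder written through `remMean`. -/
lemma taylor_remMean {q : ℕ} {f : ℝ → ℝ} (hf : ContDiff ℝ q f) (x h : ℝ) :
    f (x + h) = ∑ k ∈ Finset.range q, iteratedDeriv k f x / (Nat.factorial k : ℝ) * h ^ k
      + h ^ q * remMean q fun η => iteratedDeriv q f (x + h * η) := by
  rcases q with _ | n
  · simp [remMean]
  rcases eq_or_ne h 0 with rfl | hh
  · simp [Finset.sum_range_succ']
  have hne : x ≠ x + h := by simpa [eq_comm] using hh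
  have huniq : UniqueDiffOn ℝ (Set.uIcc x (x + h)) := uniqueDiffOn_Icc (by simpa using hh)
  have hder : ∀ k ≤ n + 1, ∀ y ∈ Set.uIcc x (x + h),
      iteratedDerivWithin k f (Set.uIcc x (x + h)) y = iteratedDeriv k f y := fun k hk y hy =>
    iteratedDerivWithin_eq_iteratedDeriv huniq ((hf.of_le (by exact_mod_cast hk)).contDiffAt) hy
  have key := taylor_integral_remainder (f := f) (x := x + h) (x₀ := x) (n := n)
    (by exact_mod_cast hf.contDiffOn)
  rw [sub_eq_iff_eq_add'] at key
  rw [key, taylor_within_apply]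
  congr 1
  · refine Finset.sum_congr rfl fun k hk => ?_
    rw [hder k (by simp at hk; omega) x Set.left_mem_uIcc]
    simp only [add_sub_cancel_left, smul_eq_mul]
    ring
  · have hsub := intervalIntegral.smul_integral_comp_add_mul (a := 0) (b := 1)
      (fun t => ((x + h - t) ^ n / (Nat.factorial n : ℝ)) • iteratedDeriv (n + 1) f t) h x
    simp only [mul_zero, add_zero, mul_one] at hsub
    rw [intervalIntegral.integral_congr (g := fun t =>
      ((x + h - t) ^ n / (Nat.factorial n : ℝ)) • iteratedDeriv (n + 1) f t), ← hsub]
    · simp only [remMean, Nat.add_eq_zero_iff, one_ne_zero, and_false, if_false, smul_eq_mul,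
        Nat.add_sub_cancel, pow_succ h n]
      rw [mul_comm (h ^ n) h, mul_assoc]
      congr 1
      rw [← intervalIntegral.integral_const_mul]
      congr 1; ext η
      rw [show x + h - (x + h * η) = h * (1 - η) by ring, mul_pow]
      ring
    · intro t ht
      simp only [hder (n + 1) le_rfl t ht]

lemma Rq_eq_sum {b : ℤ → ℝ} {S : Finset ℤ} (hS : ∀ j, b j ≠ 0 → j ∈ S) (i : ℤ) (δ : ℝ) (q : ℕ)
    (f : ℝ → ℝ) :
    Rq i δ q f b
      = -∑ j ∈ S, b j * (j : ℝ) ^ q * remMean q fun η => f ((i + j * η) * δ) := by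
  rw [Rq_eq_remMean, finsum_eq_sum_of_support_subset]
  intro j hj
  exact hS j (left_ne_zero_of_mul (left_ne_zero_of_mul hj))

lemma Rq_add {b : ℤ → ℝ} {S : Finset ℤ} (hS : ∀ j, b j ≠ 0 → j ∈ S) (i : ℤ) (δ : ℝ) (q : ℕ)
    {f g : ℝ → ℝ} (hf : Continuous f) (hg : Continuous g) :
    Rq i δ q (fun x => f x + g x) b = Rq i δ q f b + Rq i δ q g b := by
  simp only [Rq_eq_sum hS]
  rw [← neg_add, ← Finset.sum_add_distrib]
  congr 1
  refine Finset.sum_congr rfl fun j _ => ?_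
  rw [remMean_add q (by fun_prop) (by fun_prop)]
  ring

lemma Rq_const_mul {b : ℤ → ℝ} {S : Finset ℤ} (hS : ∀ j, b j ≠ 0 → j ∈ S) (i : ℤ) (δ : ℝ)
    (q : ℕ) (c : ℝ) (f : ℝ → ℝ) :
    Rq i δ q (fun x => c * f x) b = c * Rq i δ q f b := by
  simp only [Rq_eq_sum hS, remMean_const_mul]
  rw [mul_neg, Finset.mul_sum]
  congr 1
  exact Finset.sum_congr rfl fun j _ => by ring

lemma Rq_abs_rpow {b : ℤ → ℝ} {S : Finset ℤ} (hS : ∀ j, b j ≠ 0 → j ∈ S) (i : ℤ) {δ : ℝ}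
    (hδ : 0 < δ) (q : ℕ) (s : ℝ) :
    Rq i δ q (fun x => |x| ^ s) b = δ ^ s * Rq i 1 q (fun x => |x| ^ s) b := by
  rw [← Rq_const_mul hS]
  simp only [Rq_eq_sum hS]
  congr 1
  refine Finset.sum_congr rfl fun j _ => ?_
  congr 2
  ext η
  rw [abs_mul, Real.mul_rpow (abs_nonneg _) (abs_nonneg _), abs_of_pos hδ, mul_one, mul_comm]

/-- Sequences with vanishing moments annihilate polynomials under `remMean`. -/
lemma sum_mul_remMean_pow {b : ℤ → ℝ} {S : Finset ℤ} {Q : ℕ}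
    (hmom : ∀ k < Q, ∑ j ∈ S, b j * (j : ℝ) ^ k = 0) {q k : ℕ} (hk : q + k < Q) (x y : ℝ) :
    ∑ j ∈ S, b j * (j : ℝ) ^ q * remMean q (fun η => (x + j * η * y) ^ k) = 0 := by
  have expand : ∀ j : ℤ, remMean q (fun η => (x + j * η * y) ^ k)
      = ∑ t ∈ Finset.range (k + 1),
        (j : ℝ) ^ t * (y ^ t * x ^ (k - t) * (k.choose t : ℝ) * remMean q fun η => η ^ t) := by
    intro j
    have : (fun η : ℝ => (x + j * η * y) ^ k) = fun η => ∑ t ∈ Finset.range (k + 1),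
        ((j : ℝ) ^ t * (y ^ t * x ^ (k - t) * (k.choose t : ℝ))) * η ^ t := by
      ext η
      rw [add_comm, add_pow]
      exact Finset.sum_congr rfl fun t _ => by rw [mul_pow, mul_pow]; ring
    rw [this, remMean_sum q _ fun t _ => by fun_prop]
    exact Finset.sum_congr rfl fun t _ => by rw [remMean_const_mul]; ring
  simp only [expand, Finset.mul_sum]
  rw [Finset.sum_comm]
  refine Finset.sum_eq_zero fun t ht => ?_
  have := hmom (q + t) (by simp at ht; omega)
  calc _ = (∑ j ∈ S, b j * (j : ℝ) ^ (q + t))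
        * (y ^ t * x ^ (k - t) * (k.choose t : ℝ) * remMean q fun η => η ^ t) := by
        rw [Finset.sum_mul]
        exact Finset.sum_congr rfl fun j _ => by rw [pow_add]; ring
    _ = 0 := by rw [this, zero_mul]

lemma Rq_const {b : ℤ → ℝ} {S : Finset ℤ} (hS : ∀ j, b j ≠ 0 → j ∈ S) {Q : ℕ}
    (hmom : ∀ k < Q, ∑ j ∈ S, b j * (j : ℝ) ^ k = 0) (i : ℤ) (δ : ℝ) {q : ℕ} (hq : q < Q)
    (c : ℝ) : Rq i δ q (fun _ => c) b = 0 := by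
  have h := sum_mul_remMean_pow hmom (q := q) (k := 0) (by simpa using hq) 0 0
  have h2 := Rq_const_mul hS i δ q c (fun _ => 1)
  simp only [mul_one] at h2
  simp only [pow_zero] at h
  rw [h2, Rq_eq_sum hS, h]
  simp

/-- Taylor's formula for the filtered function `∑ j, b j * f ((i + j) * δ)`. -/
lemma sum_mul_eq_Rq {b : ℤ → ℝ} {S : Finset ℤ} (hS : ∀ j, b j ≠ 0 → j ∈ S) {q : ℕ}
    (hmom : ∀ k < q, ∑ j ∈ S, b j * (j : ℝ) ^ k = 0) {f : ℝ → ℝ} (hf : ContDiff ℝ q f)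
    (i : ℤ) (δ : ℝ) :
    ∑ j ∈ S, b j * f ((i + j) * δ) = -(δ ^ q * Rq i δ q (iteratedDeriv q f) b) := by
  have h1 : ∀ j : ℤ, b j * f ((i + j) * δ)
      = ∑ k ∈ Finset.range q, b j * (j : ℝ) ^ k *
          (iteratedDeriv k f (i * δ) / (Nat.factorial k : ℝ) * δ ^ k)
        + δ ^ q * (b j * (j : ℝ) ^ q *
            remMean q fun η => iteratedDeriv q f ((i + j * η) * δ)) := by
    intro j
    rw [show ((i : ℝ) + j) * δ = i * δ + j * δ by ring, taylor_remMean hf, mul_add,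
      Finset.mul_sum]
    congr 1
    · exact Finset.sum_congr rfl fun k _ => by rw [mul_pow]; ring
    · simp only [show ∀ η : ℝ, (i : ℝ) * δ + j * δ * η = (i + j * η) * δ from fun η => by ring]
      rw [mul_pow]; ring
  simp only [h1, Finset.sum_add_distrib, ← Finset.mul_sum]
  rw [Finset.sum_comm, Finset.sum_eq_zero, Rq_eq_sum hS]
  · ring
  · intro k hk
    rw [← Finset.sum_mul, hmom k (by simpa using hk), zero_mul]

/-- On a compact interval a function with bounded `d`-th derivative is uniformly close to a
polynomial of degree less than `d`. -/
lemma exists_polynomial_approx {f : ℝ → ℝ} {d : ℕ} (hd : 1 ≤ d) {x₀ x₁ B : ℝ} (hx : x₀ < x₁)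
    {s : Set ℝ} (hs : IsOpen s) (hsub : Set.Icc x₀ x₁ ⊆ s) (hf : ContDiffOn ℝ d f s)
    (hB : ∀ y ∈ Set.Icc x₀ x₁, |iteratedDeriv d f y| ≤ B) :
    ∃ c : ℕ → ℝ, ∀ y ∈ Set.Icc x₀ x₁,
      |f y - ∑ k ∈ Finset.range d, c k * (y - x₀) ^ k| ≤ B * (x₁ - x₀) ^ d := by
  obtain ⟨n, rfl⟩ : ∃ n, d = n + 1 := ⟨d - 1, by omega⟩
  have hB0 : 0 ≤ B := (abs_nonneg _).trans (hB x₀ ⟨le_rfl, hx.le⟩)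
  refine ⟨fun k => iteratedDerivWithin k f (Set.Icc x₀ x₁) x₀ / (Nat.factorial k : ℝ),
    fun y hy => ?_⟩
  have key := taylor_mean_remainder_bound (C := B) (n := n) hx.le (hf.mono hsub) hy
    fun z hz => by
      rw [iteratedDerivWithin_eq_iteratedDeriv (uniqueDiffOn_Icc hx) _ hz]
      · exact hB z hz
      · exact hf.contDiffAt (hs.mem_nhds (hsub hz))
  rw [taylor_within_apply, Real.norm_eq_abs] at key
  have hsum : ∑ k ∈ Finset.range (n + 1),
      ((Nat.factorial k : ℝ)⁻¹ * (y - x₀) ^ k) • iteratedDerivWithin k f (Set.Icc x₀ x₁) x₀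
      = ∑ k ∈ Finset.range (n + 1),
        iteratedDerivWithin k f (Set.Icc x₀ x₁) x₀ / (Nat.factorial k : ℝ) * (y - x₀) ^ k :=
    Finset.sum_congr rfl fun k _ => by rw [smul_eq_mul]; ring
  rw [hsum] at key
  refine key.trans ?_
  have h1 : (y - x₀) ^ (n + 1) ≤ (x₁ - x₀) ^ (n + 1) :=
      pow_le_pow_left₀ (by linarith [hy.1]) (by linarith [hy.2]) _
  have h2 : (1 : ℝ) ≤ Nat.factorial n :=
      by exact_mod_cast Nat.one_le_iff_ne_zero.2 (Nat.factorial_ne_zero _)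
  refine (div_le_self ?_ h2).trans (mul_le_mul_of_nonneg_left h1 hB0)
  exact mul_nonneg hB0 (pow_nonneg (by linarith [hy.1]) _)

/-- Decay of `Rq` far from the origin when `f` has a `d`-th derivative of power growth. -/
lemma exists_abs_Rq_le {b : ℤ → ℝ} {N : ℕ} (hN : 1 ≤ N)
    (hS : ∀ j, b j ≠ 0 → j ∈ Finset.Icc (-(N : ℤ)) N) {q d : ℕ} (hd : 1 ≤ d)
    (hmom : ∀ k < q + d, ∑ j ∈ Finset.Icc (-(N : ℤ)) N, b j * (j : ℝ) ^ k = 0)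
    {f : ℝ → ℝ} (hfc : Continuous f) (hf : ContDiffOn ℝ d f {(0:ℝ)}ᶜ) {K γ : ℝ} (hK : 0 ≤ K)
    (hγ : γ ≤ 0) (hder : ∀ h : ℝ, h ≠ 0 → |iteratedDeriv d f h| ≤ K * |h| ^ γ) :
    ∃ c : ℝ, 0 ≤ c ∧ ∀ δ : ℝ, 0 < δ → ∀ i : ℤ, 2 * (N : ℤ) ≤ |i| →
      |Rq i δ q f b| ≤ c * |(i : ℝ)| ^ γ * δ ^ (γ + d) := by
  set S := Finset.Icc (-(N : ℤ)) N
  refine ⟨(∑ j ∈ S, |b j * (j : ℝ) ^ q|) * (K * (1 / 2) ^ γ * (2 * N) ^ d), by positivity,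
    fun δ hδ i hi => ?_⟩
  have hN' : (1 : ℝ) ≤ N := by exact_mod_cast hN
  have hi' : 2 * (N : ℝ) ≤ |(i : ℝ)| := by exact_mod_cast hi
  have hlow : ∀ y ∈ Set.Icc ((i - N) * δ) ((i + N) * δ), 1 / 2 * |(i : ℝ)| * δ ≤ |y| := by
    intro y hy
    have h1 : |(i : ℝ) * δ - y| ≤ N * δ := by
      rw [abs_le]; constructor <;> linarith [hy.1, hy.2]
    have h2 := abs_sub_abs_le_abs_sub ((i : ℝ) * δ) y
    rw [abs_mul, abs_of_pos hδ] at h2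
    nlinarith
  have hpos : 0 < 1 / 2 * |(i : ℝ)| * δ := by
    have : 0 < |(i : ℝ)| := by linarith
    positivity
  obtain ⟨c, hc⟩ := exists_polynomial_approx hd (x₀ := (i - N) * δ) (x₁ := (i + N) * δ)
    (B := K * (1 / 2 * |(i : ℝ)| * δ) ^ γ) (by nlinarith) isOpen_compl_singleton
    (fun y hy => by
      have := hlow y hy
      exact abs_pos.1 (hpos.trans_le this)) hf
    (fun y hy => by
      have := hlow y hy
      exact (hder y (abs_pos.1 (hpos.trans_le this))).trans
        (mul_le_mul_of_nonneg_left (Real.rpow_le_rpow_of_nonpos hpos this hγ) hK))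
  set x₀ : ℝ := (i - N) * δ
  set B : ℝ := K * (1 / 2 * |(i : ℝ)| * δ) ^ γ * ((i + N) * δ - x₀) ^ d
  have hpoly : ∑ j ∈ S, b j * (j : ℝ) ^ q * remMean q (fun η =>
      ∑ k ∈ Finset.range d, c k * ((i + j * η) * δ - x₀) ^ k) = 0 := by
    have : ∀ j : ℤ, remMean q (fun η =>
        ∑ k ∈ Finset.range d, c k * ((i + j * η) * δ - x₀) ^ k)
        = ∑ k ∈ Finset.range d, c k * remMean q (fun η => ((i * δ - x₀) + j * η * δ) ^ k) := by
      intro j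
      rw [remMean_sum q _ fun k _ => by fun_prop]
      refine Finset.sum_congr rfl fun k _ => ?_
      rw [remMean_const_mul]
      congr 2
      ext η
      ring
    simp only [this, Finset.mul_sum]
    rw [Finset.sum_comm]
    refine Finset.sum_eq_zero fun k hk => ?_
    have h0 := sum_mul_remMean_pow hmom (q := q) (k := k) (by simp at hk; omega) (i * δ - x₀) δ
    calc _ = c k * ∑ j ∈ S, b j * (j : ℝ) ^ q *
          remMean q (fun η => ((i * δ - x₀) + j * η * δ) ^ k) := by
          rw [Finset.mul_sum]
          exact Finset.sum_congr rfl fun j _ => by ring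
      _ = 0 := by rw [h0, mul_zero]
  have hsplit : Rq i δ q f b = -∑ j ∈ S, b j * (j : ℝ) ^ q * remMean q (fun η =>
      f ((i + j * η) * δ) - ∑ k ∈ Finset.range d, c k * ((i + j * η) * δ - x₀) ^ k) := by
    have : ∀ j : ℤ, remMean q (fun η => f ((i + j * η) * δ))
        = remMean q (fun η => f ((i + j * η) * δ)
            - ∑ k ∈ Finset.range d, c k * ((i + j * η) * δ - x₀) ^ k)
          + remMean q (fun η => ∑ k ∈ Finset.range d, c k * ((i + j * η) * δ - x₀) ^ k) := by
      intro j
      rw [← remMean_add q (by fun_prop) (by fun_prop)]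
      simp
    rw [Rq_eq_sum hS]
    simp only [this, mul_add, Finset.sum_add_distrib, hpoly, add_zero]
  have hB : B = K * (1 / 2) ^ γ * (2 * N) ^ d * (|(i : ℝ)| ^ γ * δ ^ (γ + d)) := by
    simp only [B, x₀]
    rw [show ((i : ℝ) + N) * δ - (i - N) * δ = 2 * N * δ by ring, mul_pow (2 * (N : ℝ)) δ,
      Real.rpow_add hδ, Real.rpow_natCast, Real.mul_rpow (by positivity) hδ.le,
      Real.mul_rpow (by positivity) (by positivity)]
    ring
  rw [hsplit, abs_neg]
  calc _ ≤ ∑ j ∈ S, |b j * (j : ℝ) ^ q| * B := by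
        refine (Finset.abs_sum_le_sum_abs _ _).trans (Finset.sum_le_sum fun j hj => ?_)
        rw [abs_mul]
        refine mul_le_mul_of_nonneg_left (abs_remMean_le q fun η hη => hc _ ?_) (abs_nonneg _)
        have hj' : -(N : ℝ) ≤ j ∧ (j : ℝ) ≤ N := by
          have := Finset.mem_Icc.1 hj
          exact ⟨by exact_mod_cast this.1, by exact_mod_cast this.2⟩
        have h1 : -(N : ℝ) ≤ j * η := by nlinarith [hη.1, hη.2, hj'.1, hj'.2]
        have h2 : (j : ℝ) * η ≤ N := by nlinarith [hη.1, hη.2, hj'.1, hj'.2]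
        constructor
        · exact mul_le_mul_of_nonneg_right (by linarith) hδ.le
        · exact mul_le_mul_of_nonneg_right (by linarith) hδ.le
    _ = _ := by rw [← Finset.sum_mul, hB]; ring

lemma contDiffOn_abs_rpow (s : ℝ) (d : ℕ) :
    ContDiffOn ℝ d (fun x : ℝ => |x| ^ s) {(0:ℝ)}ᶜ := fun _ hx =>
  ((contDiffAt_abs hx).rpow_const_of_ne (abs_ne_zero.2 hx)).contDiffWithinAt

/-- Size of the derivatives of `|x| ^ s` away from the origin. -/
lemma exists_abs_iteratedDeriv_abs_rpow_le (s : ℝ) (d : ℕ) :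
    ∃ K : ℝ, 0 ≤ K ∧ ∀ h : ℝ, h ≠ 0 →
      |iteratedDeriv d (fun x : ℝ => |x| ^ s) h| ≤ K * |h| ^ (s - d) := by
  refine ⟨|(descPochhammer ℝ d).eval s|, abs_nonneg _, ?_⟩
  have hpos : ∀ h : ℝ, 0 < h →
      |iteratedDeriv d (fun x : ℝ => |x| ^ s) h|
        ≤ |(descPochhammer ℝ d).eval s| * |h| ^ (s - d) := by
    intro h hh
    have : (fun x : ℝ => |x| ^ s) =ᶠ[nhds h] fun x => x ^ s := by
      filter_upwards [lt_mem_nhds hh] with x hx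
      rw [abs_of_pos hx]
    rw [this.iteratedDeriv_eq, iteratedDeriv_eq_iterate, Real.iter_deriv_rpow_const, abs_mul,
      abs_of_pos hh, abs_of_pos (Real.rpow_pos_of_pos hh _)]
  intro h hh
  rcases hh.lt_or_gt with hlt | hgt
  · have heven : (fun x : ℝ => |x| ^ s) = fun x : ℝ => (fun y : ℝ => |y| ^ s) (-x) := by
      ext x; simp
    have hneg := iteratedDeriv_comp_neg d (fun y : ℝ => |y| ^ s) h
    rw [heven, hneg, smul_eq_mul, abs_mul, abs_pow, abs_neg, abs_one, one_pow,
      one_mul, ← abs_neg h]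
    exact hpos (-h) (by linarith)
  · exact hpos h hgt

lemma hasDerivAt_abs_rpow_mul_self {p : ℝ} (hp : 0 < p) (x : ℝ) :
    HasDerivAt (fun x : ℝ => |x| ^ p * x) ((p + 1) * |x| ^ p) x := by
  rcases eq_or_ne x 0 with rfl | hx
  · rw [abs_zero, Real.zero_rpow hp.ne', mul_zero, hasDerivAt_iff_tendsto_slope]
    have hc : Tendsto (fun x : ℝ => |x| ^ p) (nhds 0) (nhds 0) := by
      have : Continuous fun x : ℝ => |x| ^ p := continuous_abs.rpow_const fun _ => Or.inr hp.le
      simpa [Real.zero_rpow hp.ne'] using this.tendsto 0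
    refine (hc.mono_left nhdsWithin_le_nhds).congr' ?_
    filter_upwards [self_mem_nhdsWithin] with y hy
    have : y ≠ 0 := hy
    simp [slope_def_field, this]
  · have hq : HasDerivAt (fun x : ℝ => |x| ^ (p + 2) / x) _ x :=
      (hasDerivAt_abs_rpow x (show 1 < p + 2 by linarith)).div (hasDerivAt_id x) hx
    have hsq : ∀ y : ℝ, y ≠ 0 → |y| ^ (p + 2) = |y| ^ p * y ^ 2 := fun y hy => by
      rw [Real.rpow_add (abs_pos.2 hy), Real.rpow_two, sq_abs]
    refine (hq.congr_of_eventuallyEq ?_).congr_deriv ?_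
    · filter_upwards [isOpen_ne.mem_nhds hx] with y hy
      have : y ≠ 0 := hy
      rw [hsq y this]; field_simp
    · simp only [hsq x hx, add_sub_cancel_right]
      field_simp
      ring

/-- The function `|x| ^ (2 D + s)` is a `2 D`-fold antiderivative of a multiple of `|x| ^ s`. -/
lemma contDiff_abs_rpow_two_mul_add {s : ℝ} (hs : 0 < s) (D : ℕ) :
    ContDiff ℝ (2 * D : ℕ) (fun x : ℝ => |x| ^ (2 * (D : ℝ) + s)) ∧
      ∃ c : ℝ, iteratedDeriv (2 * D) (fun x : ℝ => |x| ^ (2 * (D : ℝ) + s))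
        = fun x => c * |x| ^ s := by
  induction D with
  | zero =>
    refine ⟨?_, 1, by simp⟩
    simp only [Nat.cast_zero, mul_zero, zero_add]
    exact contDiff_zero.2 (continuous_abs.rpow_const fun _ => Or.inr hs.le)
  | succ D ih =>
    obtain ⟨hcd, c, hc⟩ := ih
    set p : ℝ := 2 * (D : ℝ) + s with hp
    have hp0 : 0 < p := by positivity
    have hpe : 2 * ((D + 1 : ℕ) : ℝ) + s = p + 2 := by push_cast; ring
    have h1 : ∀ x, HasDerivAt (fun x : ℝ => |x| ^ (p + 2)) ((p + 2) * (|x| ^ p * x)) x := by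
      intro x
      have := hasDerivAt_abs_rpow x (show 1 < p + 2 by linarith)
      rwa [add_sub_cancel_right, mul_assoc] at this
    have h2 : ∀ x, HasDerivAt (fun x : ℝ => (p + 2) * (|x| ^ p * x))
        ((p + 2) * ((p + 1) * |x| ^ p)) x := fun x =>
      (hasDerivAt_abs_rpow_mul_self hp0 x).const_mul _
    have d1 : deriv (fun x : ℝ => |x| ^ (p + 2)) = fun x => (p + 2) * (|x| ^ p * x) :=
      funext fun x => (h1 x).deriv
    have d2 : deriv (fun x : ℝ => (p + 2) * (|x| ^ p * x))
        = fun x => ((p + 2) * (p + 1)) * |x| ^ p := funext fun x => by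
      rw [(h2 x).deriv]; ring
    rw [hpe, show 2 * (D + 1) = 2 * D + 1 + 1 by ring]
    constructor
    · have e1 : ContDiff ℝ ((2 * D : ℕ) + 1 : WithTop ℕ∞)
          (fun x : ℝ => (p + 2) * (|x| ^ p * x)) := by
        rw [contDiff_succ_iff_deriv]
        refine ⟨fun x => (h2 x).differentiableAt, fun h => absurd h (WithTop.natCast_ne_top _), ?_⟩
        rw [d2]
        exact contDiff_const.mul hcd
      have e2 : ContDiff ℝ ((2 * D + 1 : ℕ) + 1 : WithTop ℕ∞)
          (fun x : ℝ => |x| ^ (p + 2)) := by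
        rw [contDiff_succ_iff_deriv]
        refine ⟨fun x => (h1 x).differentiableAt, fun h => absurd h (WithTop.natCast_ne_top _), ?_⟩
        rw [d1]
        exact_mod_cast e1
      exact_mod_cast e2
    · refine ⟨(p + 2) * (p + 1) * c, ?_⟩
      rw [iteratedDeriv_succ', d1, iteratedDeriv_succ', d2]
      ext x
      rw [iteratedDeriv_const_mul_field, hc]
      ring

lemma seqConv_eq_sum {a a' : ℤ → ℝ} {P : Finset ℤ} (ha : ∀ j, a j ≠ 0 → j ∈ P) (m : ℤ) :
    seqConv a a' m = ∑ k ∈ P, a k * a' (k - m) :=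
  finsum_eq_sum_of_support_subset _ fun j hj => ha j (left_ne_zero_of_mul hj)

lemma seqConv_ne_zero {a a' : ℤ → ℝ} {P T : Finset ℤ} (ha : ∀ j, a j ≠ 0 → j ∈ P)
    (ha' : ∀ j, a' j ≠ 0 → j ∈ P) (hT : ∀ k ∈ P, ∀ l ∈ P, k - l ∈ T) (m : ℤ)
    (hm : seqConv a a' m ≠ 0) : m ∈ T := by
  rw [seqConv_eq_sum ha] at hm
  obtain ⟨k, hk, hne⟩ := Finset.exists_ne_zero_of_sum_ne_zero hm
  simpa using hT k hk (k - m) (ha' _ (right_ne_zero_of_mul hne))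

lemma sum_seqConv_mul {a a' : ℤ → ℝ} {P T : Finset ℤ} (ha : ∀ j, a j ≠ 0 → j ∈ P)
    (ha' : ∀ j, a' j ≠ 0 → j ∈ P) (hT : ∀ k ∈ P, ∀ l ∈ P, k - l ∈ T) (g : ℤ → ℝ) :
    ∑ m ∈ T, seqConv a a' m * g m = ∑ k ∈ P, ∑ l ∈ P, a k * a' l * g (k - l) := by
  simp only [seqConv_eq_sum ha, Finset.sum_mul]
  rw [Finset.sum_comm]
  refine Finset.sum_congr rfl fun k hk => ?_
  rw [← Finset.sum_subset (s₁ := P.image fun l => k - l)]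
  · rw [Finset.sum_image fun x _ y _ h => by simpa using h]
    simp
  · intro m hm
    obtain ⟨l, hl, rfl⟩ := Finset.mem_image.1 hm
    exact hT k hk l hl
  · intro m _ hm
    have : a' (k - m) = 0 := by
      by_contra h
      exact hm (Finset.mem_image.2 ⟨k - m, ha' _ h, by ring⟩)
    rw [this, mul_zero, zero_mul]

lemma sum_seqConv_mul_pow {a a' : ℤ → ℝ} {P T : Finset ℤ} (ha : ∀ j, a j ≠ 0 → j ∈ P)
    (ha' : ∀ j, a' j ≠ 0 → j ∈ P) (hT : ∀ k ∈ P, ∀ l ∈ P, k - l ∈ T) (K : ℕ) :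
    ∑ m ∈ T, seqConv a a' m * (m : ℝ) ^ K
      = ∑ t ∈ Finset.range (K + 1), (∑ k ∈ P, a k * (k : ℝ) ^ t)
          * (∑ l ∈ P, a' l * (l : ℝ) ^ (K - t)) * ((-1) ^ (K - t) * (K.choose t : ℝ)) := by
  rw [sum_seqConv_mul ha ha' hT fun m => (m : ℝ) ^ K]
  have : ∀ k l : ℤ, a k * a' l * ((k - l : ℤ) : ℝ) ^ K
      = ∑ t ∈ Finset.range (K + 1), (a k * (k : ℝ) ^ t) * (a' l * (l : ℝ) ^ (K - t))
          * ((-1) ^ (K - t) * (K.choose t : ℝ)) := by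
    intro k l
    rw [Int.cast_sub, sub_eq_add_neg, add_pow, Finset.mul_sum]
    exact Finset.sum_congr rfl fun t _ => by rw [neg_pow (l : ℝ)]; ring
  simp only [this]
  have swap : ∀ F : ℤ → ℤ → ℕ → ℝ, ∑ k ∈ P, ∑ l ∈ P, ∑ t ∈ Finset.range (K + 1), F k l t
      = ∑ t ∈ Finset.range (K + 1), ∑ k ∈ P, ∑ l ∈ P, F k l t := fun F => by
    rw [Finset.sum_comm]
    simp only [Finset.sum_comm (s := P) (t := Finset.range (K + 1))]
    exact Finset.sum_congr rfl fun _ _ => Finset.sum_comm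
  rw [swap]
  refine Finset.sum_congr rfl fun t _ => ?_
  rw [Finset.sum_mul_sum, Finset.sum_mul]
  exact Finset.sum_congr rfl fun k _ => by rw [Finset.sum_mul]

/-- The order of `seqConv a a'` is the sum of the orders: vanishing moments. -/
lemma sum_seqConv_mul_pow_eq_zero {a a' : ℤ → ℝ} {P T : Finset ℤ}
    (ha : ∀ j, a j ≠ 0 → j ∈ P) (ha' : ∀ j, a' j ≠ 0 → j ∈ P)
    (hT : ∀ k ∈ P, ∀ l ∈ P, k - l ∈ T) {M M' : ℕ}
    (hmom : ∀ k < M, ∑ j ∈ P, a j * (j : ℝ) ^ k = 0)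
    (hmom' : ∀ k < M', ∑ j ∈ P, a' j * (j : ℝ) ^ k = 0) (K : ℕ) (hK : K < M + M') :
    ∑ m ∈ T, seqConv a a' m * (m : ℝ) ^ K = 0 := by
  rw [sum_seqConv_mul_pow ha ha' hT]
  refine Finset.sum_eq_zero fun t ht => ?_
  rcases lt_or_ge t M with h | h
  · rw [hmom t h]; ring
  · rw [hmom' (K - t) (by simp at ht; omega)]; ring

/-- The order of `seqConv a a'` is the sum of the orders: the first nonzero moment. -/
lemma sum_seqConv_mul_pow_ne_zero {a a' : ℤ → ℝ} {P T : Finset ℤ}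
    (ha : ∀ j, a j ≠ 0 → j ∈ P) (ha' : ∀ j, a' j ≠ 0 → j ∈ P)
    (hT : ∀ k ∈ P, ∀ l ∈ P, k - l ∈ T) {M M' : ℕ}
    (hmom : ∀ k < M, ∑ j ∈ P, a j * (j : ℝ) ^ k = 0)
    (hmom' : ∀ k < M', ∑ j ∈ P, a' j * (j : ℝ) ^ k = 0)
    (hmomM : ∑ j ∈ P, a j * (j : ℝ) ^ M ≠ 0) (hmomM' : ∑ j ∈ P, a' j * (j : ℝ) ^ M' ≠ 0) :
    ∑ m ∈ T, seqConv a a' m * (m : ℝ) ^ (M + M') ≠ 0 := by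
  rw [sum_seqConv_mul_pow ha ha' hT, Finset.sum_eq_single M]
  · rw [Nat.add_sub_cancel_left]
    have : ((M + M').choose M : ℝ) ≠ 0 := by
      exact_mod_cast (Nat.choose_pos (Nat.le_add_right M M')).ne'
    exact mul_ne_zero (mul_ne_zero hmomM hmomM') (mul_ne_zero (by simp) this)
  · intro t ht htM
    rcases lt_or_ge t M with h | h
    · rw [hmom t h]; ring
    · rw [hmom' (M + M' - t) (by simp at ht; omega)]; ring
  · intro h
    exact absurd (by simp) h

/-- A finite combination of translates of a non-polynomial power that vanishes at all large
integers has only vanishing moments. -/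
lemma sum_mul_pow_eq_zero_of_rpow {b : ℤ → ℝ} {N : ℕ} {p : ℝ} (hp : ∀ k : ℕ, p ≠ k)
    (h : ∀ n : ℕ, N < n → ∑ j ∈ Finset.Icc (-(N : ℤ)) N, b j * |(n : ℝ) + j| ^ p = 0) (k : ℕ) :
    ∑ j ∈ Finset.Icc (-(N : ℤ)) N, b j * (j : ℝ) ^ k = 0 := by
  set S := Finset.Icc (-(N : ℤ)) N
  let G : ℕ → ℝ → ℝ := fun k x => ∑ j ∈ S, b j * (j : ℝ) ^ k * (1 + j * x) ^ (p - k)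
  have hbase : ∀ᶠ x in nhds (0:ℝ), ∀ j ∈ S, 0 < 1 + (j : ℝ) * x := by
    rw [Filter.eventually_all_finset]
    intro j _
    have : ContinuousAt (fun x : ℝ => 1 + (j : ℝ) * x) 0 := by fun_prop
    exact this.eventually (lt_mem_nhds (by simp))
  have han : AnalyticAt ℝ (G 0) 0 := by
    refine Finset.analyticAt_fun_sum _ fun j _ => analyticAt_const.mul ?_
    refine ContDiffAt.analyticAt ?_
    exact ContDiffAt.rpow_const_of_ne (by fun_prop) (by simp)
  have hzero : ∀ n : ℕ, N < n → G 0 (n : ℝ)⁻¹ = 0 := by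
    intro n hn
    have hn0 : (0 : ℝ) < n := by exact_mod_cast (Nat.zero_le N).trans_lt hn
    have h1 := h n hn
    have h2 : ∑ j ∈ S, b j * |(n : ℝ) + j| ^ p = (n : ℝ) ^ p * G 0 (n : ℝ)⁻¹ := by
      simp only [G, Finset.mul_sum]
      refine Finset.sum_congr rfl fun j hj => ?_
      have hj' : -(n : ℝ) < j := by
        have := (Finset.mem_Icc.1 hj).1
        exact_mod_cast (show -(n : ℤ) < j by omega)
      have h3 : (n : ℝ) + j = n * (1 + j * (n : ℝ)⁻¹) := by field_simp
      have h4 : 0 ≤ 1 + j * (n : ℝ)⁻¹ := by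
        have : 0 < (n : ℝ) * (1 + j * (n : ℝ)⁻¹) := by rw [← h3]; linarith
        exact (pos_of_mul_pos_right this hn0.le).le
      rw [abs_of_pos (by linarith), h3, Real.mul_rpow hn0.le h4]
      simp
      ring
    rw [h2] at h1
    exact (mul_eq_zero.1 h1).resolve_left (Real.rpow_pos_of_pos hn0 p).ne'
  have hev : ∀ k, G k =ᶠ[nhds 0] fun _ => 0 := by
    intro k
    induction k with
    | zero =>
      refine han.frequently_zero_iff_eventually_zero.1 ?_
      have ht : Tendsto (fun n : ℕ => (n : ℝ)⁻¹) atTop (nhdsWithin 0 {0}ᶜ) := by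
        refine tendsto_nhdsWithin_iff.2 ⟨tendsto_inv_atTop_nhds_zero_nat, ?_⟩
        filter_upwards [eventually_gt_atTop 0] with n hn
        simpa using hn.ne'
      refine ht.frequently (Filter.Eventually.frequently ?_)
      filter_upwards [eventually_gt_atTop N] with n hn using hzero n hn
    | succ k ih =>
      have hd := ih.eventually_nhds
      filter_upwards [hd, hbase] with x hx hb
      have hder : HasDerivAt (G k) ((p - k) * G (k + 1) x) x := by
        have : HasDerivAt (G k) (∑ j ∈ S, b j * (j : ℝ) ^ k *
            ((j : ℝ) * (p - k) * (1 + j * x) ^ (p - k - 1))) x := by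
          refine HasDerivAt.fun_sum fun j hj => HasDerivAt.const_mul _ ?_
          have h0 : HasDerivAt (fun x : ℝ => 1 + (j : ℝ) * x) j x := by
            simpa using ((hasDerivAt_id x).const_mul (j : ℝ)).const_add 1
          exact h0.rpow_const (Or.inl (hb j hj).ne')
        convert this using 1
        simp only [G, Finset.mul_sum]
        refine Finset.sum_congr rfl fun j _ => ?_
        rw [show p - ((k + 1 : ℕ) : ℝ) = p - k - 1 by push_cast; ring]
        ring
      have h0 := hder.unique ((hasDerivAt_const x (0:ℝ)).congr_of_eventuallyEq hx)
      exact (mul_eq_zero.1 h0).resolve_left (sub_ne_zero.2 (hp k))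
  have := (hev k).eq_of_nhds
  simpa [G] using this

/-- The filtered power function does not vanish identically on the integers. -/
lemma exists_Rq_abs_rpow_ne_zero {b : ℤ → ℝ} {N : ℕ}
    (hS : ∀ j, b j ≠ 0 → j ∈ Finset.Icc (-(N : ℤ)) N) {D Q : ℕ} {s : ℝ} (hs0 : 0 < s)
    (hs2 : s < 2) (hQ : 2 * D + 2 ≤ Q)
    (hmom : ∀ k < Q, ∑ j ∈ Finset.Icc (-(N : ℤ)) N, b j * (j : ℝ) ^ k = 0)
    (hmomQ : ∑ j ∈ Finset.Icc (-(N : ℤ)) N, b j * (j : ℝ) ^ Q ≠ 0)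
    {J : ℤ} (hJ : b J ≠ 0) (htop : ∀ j, J < j → b j = 0) :
    ∃ i : ℤ, Rq i 1 (2 * D) (fun x => |x| ^ s) b ≠ 0 := by
  by_contra! hall
  obtain ⟨hcd, c, hc⟩ := contDiff_abs_rpow_two_mul_add hs0 D
  have hsum : ∀ i : ℤ, ∑ j ∈ Finset.Icc (-(N : ℤ)) N,
      b j * |(i : ℝ) + j| ^ (2 * (D : ℝ) + s) = 0 := by
    intro i
    have := sum_mul_eq_Rq hS (fun k hk => hmom k (by omega)) hcd i 1
    rw [hc, Rq_const_mul hS, hall i] at this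
    simpa using this
  by_cases hs1 : s = 1
  · subst hs1
    have hpoly := sum_mul_remMean_pow hmom (q := 0) (k := 2 * D + 1) (by omega) (1 - J) 1
    have habs := hsum (1 - J)
    have hadd : ∑ j ∈ Finset.Icc (-(N : ℤ)) N, (b j * |((1 - J : ℤ) : ℝ) + j| ^ (2 * (D : ℝ) + 1)
        + b j * (j : ℝ) ^ 0 * remMean 0 fun η => ((1 - J : ℝ) + j * η * 1) ^ (2 * D + 1))
        = 2 * b J := by
      rw [Finset.sum_eq_single J]
      · rw [show 2 * (D : ℝ) + 1 = ((2 * D + 1 : ℕ) : ℝ) by push_cast; ring, Real.rpow_natCast]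
        simp [remMean]
        ring
      · intro j _ hj
        rcases lt_or_gt_of_ne hj with h | h
        · have h1 : (j : ℝ) + 1 ≤ J := by exact_mod_cast h
          rw [show 2 * (D : ℝ) + 1 = ((2 * D + 1 : ℕ) : ℝ) by push_cast; ring,
            Real.rpow_natCast, abs_of_nonpos (by push_cast; linarith),
            Odd.neg_pow ⟨D, rfl⟩]
          simp [remMean]
        · rw [htop j h]; ring
      · exact fun h => absurd (hS J hJ) h
    rw [Finset.sum_add_distrib, habs, hpoly] at hadd
    exact hJ (by linarith)
  · refine hmomQ (sum_mul_pow_eq_zero_of_rpow (p := 2 * (D : ℝ) + s) (fun k hk => hs1 ?_)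
      (fun n _ => by simpa using hsum n) Q)
    have h1 : (2 * D : ℝ) < k := by rw [← hk]; linarith
    have h2 : (k : ℝ) < 2 * D + 2 := by rw [← hk]; linarith
    have h3 : 2 * D < k := by exact_mod_cast h1
    have h4 : k < 2 * D + 2 := by exact_mod_cast h2
    obtain rfl : k = 2 * D + 1 := by omega
    push_cast at hk
    linarith

/-- The number of pairs in a rectangle with a given difference is at most the side length. -/
lemma card_diff_le (A B : ℕ) (m : ℤ) :
    ((Finset.Icc (1 : ℤ) A ×ˢ Finset.Icc (1 : ℤ) B).filter fun x => x.1 - x.2 = m).card ≤ A := by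
  calc _ ≤ (Finset.Icc (1 : ℤ) A).card := by
        refine Finset.card_le_card_of_injOn Prod.fst (fun x hx => ?_) fun x hx y hy h => ?_
        · simp only [Finset.coe_filter, Finset.mem_product, Set.mem_ofPred_eq] at hx
          exact hx.1.1
        · simp only [Finset.coe_filter, Set.mem_ofPred_eq] at hx hy
          exact Prod.ext h (by have := hx.2; have := hy.2; omega)
    _ = A := by simp

/-- Lower bound for the number of pairs in a rectangle with a given difference. -/
lemma le_card_diff (A B n l : ℕ) (hA : n ≤ A + l) (hB : n ≤ B + l) (m : ℤ) :
    (n : ℤ) - (l + 2 * |m|)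
      ≤ ((Finset.Icc (1 : ℤ) A ×ˢ Finset.Icc (1 : ℤ) B).filter fun x => x.1 - x.2 = m).card := by
  have h := Finset.card_le_card_of_injOn (s := Finset.Icc (1 + |m|) ((n : ℤ) - l - |m|))
    (t := (Finset.Icc (1 : ℤ) A ×ˢ Finset.Icc (1 : ℤ) B).filter fun x => x.1 - x.2 = m)
    (fun i => (i, i - m)) (fun i hi => ?_) fun x _ y _ h => (Prod.ext_iff.1 h).1
  · rw [Int.card_Icc] at h
    omega
  · simp only [Finset.coe_Icc, Set.mem_Icc] at hi
    simp only [Finset.coe_filter, Finset.mem_product, Finset.mem_Icc, Set.mem_ofPred_eq]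
    have := neg_abs_le m
    have := le_abs_self m
    omega

/-- Averages over large squares of a Toeplitz array converge to the total sum. -/
lemma tendsto_toeplitz_average {w : ℕ → ℤ → ℝ} {u g : ℤ → ℝ} (hg : Summable g)
    (hw : ∀ m, Tendsto (fun n => w n m) atTop (nhds (u m)))
    (hbound : ∀ᶠ n in atTop, ∀ m, |w n m| ≤ g m) {A B : ℕ → ℕ} {l : ℕ}
    (hAn : ∀ᶠ n in atTop, A n ≤ n) (hA : ∀ n, n ≤ A n + l) (hB : ∀ n, n ≤ B n + l) :
    Tendsto (fun n : ℕ => (∑ i ∈ Finset.Icc (1 : ℤ) (A n), ∑ i' ∈ Finset.Icc (1 : ℤ) (B n),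
      w n (i - i')) / n) atTop (nhds (∑' m, u m)) := by
  let c : ℕ → ℤ → ℕ := fun n m =>
    ((Finset.Icc (1 : ℤ) (A n) ×ˢ Finset.Icc (1 : ℤ) (B n)).filter fun x => x.1 - x.2 = m).card
  have hrepr : ∀ n : ℕ, (∑ i ∈ Finset.Icc (1 : ℤ) (A n), ∑ i' ∈ Finset.Icc (1 : ℤ) (B n),
      w n (i - i')) / n = ∑' m, (c n m : ℝ) / n * w n m := by
    intro n
    rw [← Finset.sum_product',
      Finset.sum_comp (f := w n) (g := fun x : ℤ × ℤ => x.1 - x.2), Finset.sum_div,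
      tsum_eq_sum (s := (Finset.Icc (1 : ℤ) (A n) ×ˢ Finset.Icc (1 : ℤ) (B n)).image
        fun x => x.1 - x.2)]
    · refine Finset.sum_congr rfl fun m _ => ?_
      rw [nsmul_eq_mul]
      ring
    · intro m hm
      have : c n m = 0 := by
        rw [Finset.card_eq_zero, Finset.filter_eq_empty_iff]
        exact fun x hx h => hm (Finset.mem_image.2 ⟨x, hx, h⟩)
      simp [this]
  simp only [hrepr]
  refine tendsto_tsum_of_dominated_convergence hg (fun m => ?_) ?_
  · have hc : Tendsto (fun n : ℕ => (c n m : ℝ) / n) atTop (nhds 1) := by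
      have hlow : Tendsto (fun n : ℕ => 1 - ((l : ℝ) + 2 * |(m : ℝ)|) / n) atTop (nhds 1) := by
        simpa using tendsto_const_nhds.sub
          (tendsto_const_div_atTop_nhds_zero_nat ((l : ℝ) + 2 * |(m : ℝ)|))
      refine tendsto_of_tendsto_of_tendsto_of_le_of_le' hlow tendsto_const_nhds ?_ ?_
      · filter_upwards [eventually_gt_atTop 0] with n hn
        have hn' : (0 : ℝ) < n := by exact_mod_cast hn
        have : ((n : ℝ)) - (l + 2 * |(m : ℝ)|) ≤ c n m := by
          exact_mod_cast le_card_diff (A n) (B n) n l (hA n) (hB n) m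
        rw [le_div_iff₀ hn', sub_mul, div_mul_cancel₀ _ hn'.ne', one_mul]
        exact this
      · filter_upwards [hAn] with n hn
        refine div_le_one_of_le₀ ?_ (Nat.cast_nonneg _)
        exact_mod_cast (card_diff_le (A n) (B n) m).trans hn
    simpa using hc.mul (hw m)
  · filter_upwards [hAn, hbound] with n hn hb m
    rw [Real.norm_eq_abs, abs_mul, abs_of_nonneg (by positivity)]
    have : (c n m : ℝ) / n ≤ 1 := by
      refine div_le_one_of_le₀ ?_ (Nat.cast_nonneg _)
      exact_mod_cast (card_diff_le (A n) (B n) m).trans hn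
    exact (mul_le_of_le_one_left (abs_nonneg _) this).trans (hb m)

lemma summable_sq_of_abs_le_rpow {u : ℤ → ℝ} {c γ : ℝ} {N : ℕ} (hγ : γ < -(1 / 2))
    (hu : ∀ m : ℤ, 2 * (N : ℤ) ≤ |m| → |u m| ≤ c * |(m : ℝ)| ^ γ) :
    Summable fun m => u m ^ 2 := by
  have hs : Summable fun m : ℤ => c ^ 2 * |(m : ℝ)| ^ (-(-(γ * 2))) :=
    (Real.summable_abs_int_rpow (by linarith)).mul_left _
  refine Summable.of_norm_bounded_eventually hs ?_
  rw [Filter.eventually_cofinite]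
  refine (Set.finite_Icc (-(2 * (N : ℤ))) (2 * N)).subset fun m hm => ?_
  by_contra hmem
  refine hm ?_
  have hm' : 2 * (N : ℤ) ≤ |m| := by
    by_contra! hlt
    exact hmem ⟨(abs_lt.1 hlt).1.le, (abs_lt.1 hlt).2.le⟩
  rw [Real.norm_eq_abs, abs_of_nonneg (sq_nonneg _), neg_neg, Real.rpow_mul (abs_nonneg _),
    Real.rpow_two, ← mul_pow]
  exact sq_le_sq' (by linarith [neg_abs_le (u m), hu m hm']) ((le_abs_self _).trans (hu m hm'))

/-- Near the origin `Rq` inherits the smallness of `r` compared with `|h| ^ s`. -/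
lemma isLittleO_Rq {b : ℤ → ℝ} {S : Finset ℤ} (hS : ∀ j, b j ≠ 0 → j ∈ S) {r : ℝ → ℝ} {s : ℝ}
    (hs : 0 < s) (hro : r =o[nhds (0:ℝ)] fun h => |h| ^ s) (i : ℤ) (q : ℕ) :
    (fun δ => Rq i δ q r b) =o[nhdsWithin 0 (Set.Ioi 0)] fun δ : ℝ => δ ^ s := by
  simp only [Rq_eq_sum hS]
  refine Asymptotics.IsLittleO.neg_left (Asymptotics.IsLittleO.fun_sum fun j _ => ?_)
  refine Asymptotics.IsLittleO.const_mul_left ?_ _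
  refine Asymptotics.isLittleO_iff.2 fun ε hε => ?_
  set R : ℝ := |(i : ℝ)| + |(j : ℝ)| + 1
  have hR : 0 < R := by positivity
  have hnear := Asymptotics.isLittleO_iff.1 hro (c := ε / R ^ s) (by positivity)
  obtain ⟨ρ, hρ, hball⟩ := Metric.eventually_nhds_iff.1 hnear
  filter_upwards [Ioo_mem_nhdsGT (show (0:ℝ) < ρ / R by positivity)] with δ hδ
  have hδ0 : 0 < δ := hδ.1
  rw [Real.norm_eq_abs, Real.norm_eq_abs, abs_of_pos (Real.rpow_pos_of_pos hδ0 _)]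
  refine abs_remMean_le q fun η hη => ?_
  have hsize : |((i : ℝ) + j * η) * δ| ≤ R * δ := by
    rw [abs_mul, abs_of_pos hδ0]
    refine mul_le_mul_of_nonneg_right ((abs_add_le _ _).trans ?_) hδ0.le
    rw [abs_mul, abs_of_nonneg hη.1]
    have := mul_le_of_le_one_right (abs_nonneg (j : ℝ)) hη.2
    simp only [R]
    linarith
  have hlt : R * δ < ρ := by
    have := (lt_div_iff₀ hR).1 hδ.2
    linarith
  have := hball (y := ((i : ℝ) + j * η) * δ) (by simpa using hsize.trans_lt hlt)
  rw [Real.norm_eq_abs, Real.norm_eq_abs, abs_of_nonneg (Real.rpow_nonneg (abs_nonneg _) _)]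
    at this
  refine this.trans ?_
  calc _ ≤ ε / R ^ s * (R * δ) ^ s := by
        gcongr
    _ = ε * δ ^ s := by
        rw [Real.mul_rpow hR.le hδ0.le]
        have : R ^ s ≠ 0 := (Real.rpow_pos_of_pos hR s).ne'
        field_simp

/-- The normalised double sums of the filtered covariance converge, the remainder `r` being
negligible at small scales. -/
lemma tendsto_average_Rq {b : ℤ → ℝ} {N : ℕ} (hN : 1 ≤ N)
    (hS : ∀ j, b j ≠ 0 → j ∈ Finset.Icc (-(N : ℤ)) N) {q d : ℕ} (hd : 1 ≤ d)
    (hmom : ∀ k < q + d, ∑ j ∈ Finset.Icc (-(N : ℤ)) N, b j * (j : ℝ) ^ k = 0)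
    {u : ℤ → ℝ} (hu : Summable fun m => u m ^ 2)
    {r : ℝ → ℝ} (hrc : Continuous r) (hrd : ContDiffOn ℝ d r {(0:ℝ)}ᶜ) {K β s : ℝ} (hK : 0 ≤ K)
    (hs : 0 < s) (hsβ : s - d < β) (hβ : β < -(1 / 2))
    (hder : ∀ h : ℝ, h ≠ 0 → |iteratedDeriv d r h| ≤ K * |h| ^ β)
    (hro : r =o[nhds (0:ℝ)] fun h => |h| ^ s) (κ : ℝ) {δ : ℕ → ℝ}
    (hδ : Tendsto δ atTop (nhdsWithin 0 (Set.Ioi 0))) {A B : ℕ → ℕ} {l : ℕ}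
    (hAn : ∀ᶠ n in atTop, A n ≤ n) (hA : ∀ n, n ≤ A n + l) (hB : ∀ n, n ≤ B n + l) :
    Tendsto (fun n : ℕ => (∑ i ∈ Finset.Icc (1 : ℤ) (A n), ∑ i' ∈ Finset.Icc (1 : ℤ) (B n),
      (u (i - i') + κ * (Rq (i - i') (δ n) q r b / δ n ^ s)) ^ 2) / n)
      atTop (nhds (∑' m, u m ^ 2)) := by
  obtain ⟨c, hc, hfar⟩ := exists_abs_Rq_le hN hS hd hmom hrc hrd hK (by linarith) hder
  have hsmall : ∀ m, Tendsto (fun n => κ * (Rq m (δ n) q r b / δ n ^ s)) atTop (nhds 0) := by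
    intro m
    simpa using ((isLittleO_Rq hS hs hro m q).tendsto_div_nhds_zero.comp hδ).const_mul κ
  let e : ℤ → ℝ := fun m => if 2 * (N : ℤ) ≤ |m| then |κ| * c * |(m : ℝ)| ^ β else 1
  have he : Summable fun m => e m ^ 2 := by
    refine summable_sq_of_abs_le_rpow (c := |κ| * c) (N := N) hβ fun m hm => ?_
    simp only [e, if_pos hm]
    rw [abs_of_nonneg (by positivity)]
  refine tendsto_toeplitz_average
    (w := fun n m => (u m + κ * (Rq m (δ n) q r b / δ n ^ s)) ^ 2)
    ((hu.mul_left 2).add (he.mul_left 2)) (fun m => ?_) ?_ hAn hA hB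
  · simpa using ((hsmall m).const_add (u m)).pow 2
  have hnear : ∀ᶠ n in atTop, ∀ m ∈ Finset.Icc (-(2 * (N : ℤ))) (2 * N),
      |κ * (Rq m (δ n) q r b / δ n ^ s)| < 1 := by
    rw [Filter.eventually_all_finset]
    intro m _
    have := (hsmall m).abs
    rw [abs_zero] at this
    exact this.eventually (gt_mem_nhds one_pos)
  filter_upwards [hnear, hδ.eventually (Ioo_mem_nhdsGT one_pos)] with n hn hδn m
  have hδ0 : 0 < δ n := hδn.1
  have hε : |κ * (Rq m (δ n) q r b / δ n ^ s)| ≤ e m := by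
    by_cases hm : 2 * (N : ℤ) ≤ |m|
    · simp only [e, if_pos hm]
      have hpow : 0 < δ n ^ s := Real.rpow_pos_of_pos hδ0 s
      rw [abs_mul, abs_div, abs_of_pos hpow, mul_assoc]
      refine mul_le_mul_of_nonneg_left ?_ (abs_nonneg _)
      rw [div_le_iff₀ hpow]
      refine (hfar _ hδ0 m hm).trans (mul_le_mul_of_nonneg_left ?_ (by positivity))
      exact Real.rpow_le_rpow_of_exponent_ge hδ0 hδn.2.le (by linarith)
    · simp only [e, if_neg hm]
      have := abs_lt.1 (not_le.1 hm)
      exact (hn m (Finset.mem_Icc.2 ⟨this.1.le, this.2.le⟩)).le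
  have hsq := sq_le_sq' (by linarith [neg_abs_le (κ * (Rq m (δ n) q r b / δ n ^ s))])
    ((le_abs_self _).trans hε)
  rw [abs_of_nonneg (sq_nonneg _)]
  nlinarith [sq_nonneg (u m - κ * (Rq m (δ n) q r b / δ n ^ s))]

/-- The filtered semi-variogram splits into its leading power part and a remainder. -/
lemma sq_sum_mul_eq {b : ℤ → ℝ} {S : Finset ℤ} (hS : ∀ j, b j ≠ 0 → j ∈ S) {D Q : ℕ}
    (hQ : 2 * D < Q) (hmom : ∀ k < Q, ∑ j ∈ S, b j * (j : ℝ) ^ k = 0) {V r : ℝ → ℝ}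
    (hV : ContDiff ℝ (2 * D : ℕ) V) {C s : ℝ} (hC : 0 < C) (hs : 0 < s)
    (hExp : ∀ h : ℝ, iteratedDeriv (2 * D) V h
      = iteratedDeriv (2 * D) V 0 + C * (-1 : ℝ) ^ D * |h| ^ s + r h) (hr : Continuous r)
    (i : ℤ) {δ : ℝ} (hδ : 0 < δ) :
    (∑ j ∈ S, b j * V ((i + j) * δ)) ^ 2
      = C ^ 2 * δ ^ (4 * (D : ℝ) + 2 * s) * (Rq i 1 (2 * D) (fun x => |x| ^ s) b
          + (-1 : ℝ) ^ D / C * (Rq i δ (2 * D) r b / δ ^ s)) ^ 2 := by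
  have habs : Continuous fun x : ℝ => |x| ^ s := continuous_abs.rpow_const fun _ => Or.inr hs.le
  rw [sum_mul_eq_Rq hS (fun k hk => hmom k (by omega)) hV, funext hExp,
    Rq_add hS i δ _ (by fun_prop) hr, Rq_add hS i δ _ (by fun_prop) (by fun_prop),
    Rq_const hS hmom i δ hQ, Rq_const_mul hS, Rq_abs_rpow hS i hδ,
    show 4 * (D : ℝ) + 2 * s = ((4 * D : ℕ) : ℝ) + s * (2 : ℕ) by push_cast; ring,
    Real.rpow_add hδ, Real.rpow_natCast, Real.rpow_mul hδ.le, Real.rpow_natCast]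
  have hpow : δ ^ s ≠ 0 := (Real.rpow_pos_of_pos hδ s).ne'
  have hsign : ((-1 : ℝ) ^ D) ^ 2 = 1 := by rw [← pow_mul, mul_comm, pow_mul]; simp
  set u := Rq i 1 (2 * D) (fun x => |x| ^ s) b
  set ρ := Rq i δ (2 * D) r b
  have hin : 0 + C * (-1 : ℝ) ^ D * (δ ^ s * u) + ρ
      = C * (-1 : ℝ) ^ D * δ ^ s * (u + (-1 : ℝ) ^ D / C * (ρ / δ ^ s)) := by
    have : C * (-1 : ℝ) ^ D * δ ^ s * ((-1 : ℝ) ^ D / C * (ρ / δ ^ s))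
        = ((-1 : ℝ) ^ D) ^ 2 * ρ := by field_simp
    rw [mul_add, this, hsign]
    ring
  rw [hin]
  calc _ = ((-1 : ℝ) ^ D) ^ 2 * (C ^ 2 * (δ ^ (2 * D) * δ ^ (2 * D) * (δ ^ s) ^ 2)
        * (u + (-1 : ℝ) ^ D / C * (ρ / δ ^ s)) ^ 2) := by ring
    _ = _ := by rw [hsign, ← pow_add, show 2 * D + 2 * D = 4 * D by ring, one_mul]

/-- under (H0)–(H2), `δ_n = n^{−α}`, and two variation sequences `a`, `a'`
with `min(M(a),M(a')) > D + s/2 + 1/4`, the covariance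
`Γ_n = 2 Σ_{i=1}^{n_a} Σ_{i'=1}^{n_{a'}} (Σ_m (a*a')_m V((i−i'+m)δ_n))²` of the quadratic
`a`- and `a'`-variations satisfies
`Γ_n / (2 n C² δ_n^{4D+2s} Σ_{i∈ℤ} R(i,1,2D,|·|^s,a*a')²) → 1`. -/
theorem stmt_8 (V r : ℝ → ℝ) (D : ℕ) (C s α : ℝ)
    (hC : 0 < C) (hs0 : 0 < s) (hs2 : s < 2) (hα0 : 0 < α) (hα1 : α ≤ 1)
    -- (H0)
    (hEven : ∀ h : ℝ, V (-h) = V h) (hSmooth : ContDiffOn ℝ (⊤ : ℕ∞) V (Set.Ioi 0))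
    -- (H1)
    (hV2D : ContDiff ℝ ((2 * D : ℕ) : ℕ∞) V)
    (hExp : ∀ h : ℝ, iteratedDeriv (2 * D) V h
      = iteratedDeriv (2 * D) V 0 + C * (-1 : ℝ) ^ D * |h| ^ s + r h)
    (hro : r =o[nhds (0:ℝ)] fun h => |h| ^ s)
    -- (H2), with d = 2 if s < 3/2 and d = 3 otherwise
    (hrd : ContDiffOn ℝ ((if s < 3/2 then 2 else 3 : ℕ) : ℕ∞) r {(0:ℝ)}ᶜ)
    (hH2 : ∃ β K : ℝ, s - (if s < 3/2 then 2 else 3 : ℕ) < β ∧ β < -(1/2) ∧ 0 < K ∧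
      (∀ h : ℝ, h ≠ 0 → |iteratedDeriv (if s < 3/2 then 2 else 3 : ℕ) r h| ≤ K * |h| ^ β) ∧
      (∀ h : ℝ, 1 < |h| → |r h| ≤ K * |h| ^ s))
    -- two variation sequences
    (a a' : ℤ → ℝ) (L L' M M' : ℕ) (hL : 1 ≤ L) (hL' : 1 ≤ L') (hM : 1 ≤ M) (hM' : 1 ≤ M')
    (hsupp : ∀ j : ℤ, a j ≠ 0 → 0 ≤ j ∧ j ≤ (L : ℤ) - 1)
    (hsupp' : ∀ j : ℤ, a' j ≠ 0 → 0 ≤ j ∧ j ≤ (L' : ℤ) - 1)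
    (ha0 : a 0 ≠ 0) (haL : a ((L : ℤ) - 1) ≠ 0)
    (ha'0 : a' 0 ≠ 0) (ha'L : a' ((L' : ℤ) - 1) ≠ 0)
    (hmom : ∀ k : ℕ, k < M → ∑ᶠ j : ℤ, a j * (j : ℝ) ^ k = 0)
    (hmomM : ∑ᶠ j : ℤ, a j * (j : ℝ) ^ M ≠ 0)
    (hmom' : ∀ k : ℕ, k < M' → ∑ᶠ j : ℤ, a' j * (j : ℝ) ^ k = 0)
    (hmomM' : ∑ᶠ j : ℤ, a' j * (j : ℝ) ^ M' ≠ 0)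
    (hMD : (D : ℝ) + s / 2 + 1 / 4 < min (M : ℝ) (M' : ℝ)) :
    Tendsto (fun n : ℕ =>
        (2 * ∑ i ∈ Finset.Icc (1 : ℤ) ((n - L + 1 : ℕ) : ℤ),
              ∑ i' ∈ Finset.Icc (1 : ℤ) ((n - L' + 1 : ℕ) : ℤ),
            (∑ᶠ m : ℤ, seqConv a a' m * V ((i - i' + m) * (n : ℝ) ^ (-α))) ^ 2)
        / (2 * (n : ℝ) * C ^ 2 * ((n : ℝ) ^ (-α)) ^ (4 * (D : ℝ) + 2 * s)
            * ∑' i : ℤ, (Rq i 1 (2 * D) (fun x => |x| ^ s) (seqConv a a')) ^ 2))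
      atTop (nhds 1) := by
  obtain ⟨β, K, hsβ, hβ, hK, hder, -⟩ := hH2
  set d : ℕ := if s < 3/2 then 2 else 3 with hd_def
  have hd1 : 1 ≤ d := by rw [hd_def]; split_ifs <;> norm_num
  have hsd : s - d < -(1 / 2) := by rw [hd_def]; split_ifs <;> push_cast <;> linarith
  have hDM : (D : ℝ) + s / 2 + 1 / 4 < M := hMD.trans_le (min_le_left _ _)
  have hDM' : (D : ℝ) + s / 2 + 1 / 4 < M' := hMD.trans_le (min_le_right _ _)
  have hd2 : 2 ≤ d := by rw [hd_def]; split_ifs <;> norm_num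
  have hQ : 2 * D + d ≤ M + M' := by
    rw [hd_def]
    split_ifs with h
    · have h1 : D < M := by exact_mod_cast (show (D : ℝ) < M by linarith)
      have h2 : D < M' := by exact_mod_cast (show (D : ℝ) < M' by linarith)
      omega
    · have h1 : D + 1 < M := by exact_mod_cast (show (D : ℝ) + 1 < M by linarith)
      have h2 : D + 1 < M' := by exact_mod_cast (show (D : ℝ) + 1 < M' by linarith)
      omega
  set N : ℕ := L + L' with hN_def
  set P : Finset ℤ := Finset.Icc (0 : ℤ) N
  set b := seqConv a a' with hb_def
  have ha : ∀ j, a j ≠ 0 → j ∈ P := fun j hj => by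
    have := hsupp j hj
    exact Finset.mem_Icc.2 ⟨this.1, by omega⟩
  have ha' : ∀ j, a' j ≠ 0 → j ∈ P := fun j hj => by
    have := hsupp' j hj
    exact Finset.mem_Icc.2 ⟨this.1, by omega⟩
  have hT : ∀ k ∈ P, ∀ l ∈ P, k - l ∈ Finset.Icc (-(N : ℤ)) N := fun k hk l hl => by
    have h1 := Finset.mem_Icc.1 hk
    have h2 := Finset.mem_Icc.1 hl
    exact Finset.mem_Icc.2 ⟨by omega, by omega⟩
  have hS : ∀ j, b j ≠ 0 → j ∈ Finset.Icc (-(N : ℤ)) N := seqConv_ne_zero ha ha' hT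
  have hfin : ∀ k : ℕ, ∑ᶠ j : ℤ, a j * (j : ℝ) ^ k = ∑ j ∈ P, a j * (j : ℝ) ^ k := fun k =>
    finsum_eq_sum_of_support_subset _ fun j hj => ha j (left_ne_zero_of_mul hj)
  have hfin' : ∀ k : ℕ, ∑ᶠ j : ℤ, a' j * (j : ℝ) ^ k = ∑ j ∈ P, a' j * (j : ℝ) ^ k := fun k =>
    finsum_eq_sum_of_support_subset _ fun j hj => ha' j (left_ne_zero_of_mul hj)
  simp only [hfin] at hmom hmomM
  simp only [hfin'] at hmom' hmomM'
  have hmomb := sum_seqConv_mul_pow_eq_zero ha ha' hT hmom hmom'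
  have hmombQ := sum_seqConv_mul_pow_ne_zero ha ha' hT hmom hmom' hmomM hmomM'
  have hbJ : b ((L : ℤ) - 1) ≠ 0 := by
    rw [hb_def, seqConv_eq_sum ha, Finset.sum_eq_single ((L : ℤ) - 1)]
    · simpa using ⟨haL, ha'0⟩
    · intro k _ hk
      by_contra hne
      have h1 := hsupp k (left_ne_zero_of_mul hne)
      have h2 := hsupp' _ (right_ne_zero_of_mul hne)
      omega
    · exact fun h => absurd (ha _ haL) h
  have htop : ∀ j, (L : ℤ) - 1 < j → b j = 0 := by
    intro j hj
    rw [hb_def, seqConv_eq_sum ha]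
    refine Finset.sum_eq_zero fun k _ => ?_
    by_contra hne
    have h1 := hsupp k (left_ne_zero_of_mul hne)
    have h2 := hsupp' _ (right_ne_zero_of_mul hne)
    omega
  set u : ℤ → ℝ := fun i => Rq i 1 (2 * D) (fun x => |x| ^ s) b with hu_def
  have habs : Continuous fun x : ℝ => |x| ^ s := continuous_abs.rpow_const fun _ => Or.inr hs0.le
  have hN1 : 1 ≤ N := by omega
  have hmombd : ∀ k < 2 * D + d, ∑ j ∈ Finset.Icc (-(N : ℤ)) N, b j * (j : ℝ) ^ k = 0 :=
    fun k hk => hmomb k (by omega)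
  have hu : Summable fun i => u i ^ 2 := by
    obtain ⟨K', hK', hder'⟩ := exists_abs_iteratedDeriv_abs_rpow_le s d
    obtain ⟨c, -, hc⟩ := exists_abs_Rq_le hN1 hS hd1 hmombd habs (contDiffOn_abs_rpow s d) hK'
      (by linarith) hder'
    refine summable_sq_of_abs_le_rpow (c := c) (N := N) hsd fun m hm => ?_
    simpa using hc 1 one_pos m hm
  have hU : 0 < ∑' i, u i ^ 2 := by
    obtain ⟨i, hi⟩ := exists_Rq_abs_rpow_ne_zero (Q := M + M') (D := D) hS hs0 hs2 (by omega) hmomb hmombQ hbJ htop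
    exact hu.tsum_pos (fun _ => sq_nonneg _) i (sq_pos_of_ne_zero hi)
  have hr : Continuous r := by
    have h1 : Continuous (iteratedDeriv (2 * D) V) := hV2D.continuous_iteratedDeriv _ le_rfl
    have h2 : r = fun h => iteratedDeriv (2 * D) V h
        - (iteratedDeriv (2 * D) V 0 + C * (-1 : ℝ) ^ D * |h| ^ s) := by
      ext h; rw [hExp h]; ring
    rw [h2]
    fun_prop
  have hδ : Tendsto (fun n : ℕ => (n : ℝ) ^ (-α)) atTop (nhdsWithin 0 (Set.Ioi 0)) := by
    refine tendsto_nhdsWithin_iff.2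
      ⟨(tendsto_rpow_neg_atTop hα0).comp tendsto_natCast_atTop_atTop, ?_⟩
    filter_upwards [eventually_gt_atTop 0] with n hn
    exact Real.rpow_pos_of_pos (by exact_mod_cast hn) _
  have hlim := tendsto_average_Rq hN1 hS hd1 hmombd hu hr hrd hK.le hs0 hsβ hβ hder hro
    ((-1 : ℝ) ^ D / C) hδ (A := fun n => n - L + 1) (B := fun n => n - L' + 1) (l := N)
    (by filter_upwards [eventually_gt_atTop 0] with n hn; omega) (fun n => by omega)
    (fun n => by omega)
  have hlim' := hlim.div_const (∑' i, u i ^ 2)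
  rw [div_self hU.ne'] at hlim'
  refine hlim'.congr' ?_
  filter_upwards [eventually_gt_atTop 0] with n hn
  have hn' : (0 : ℝ) < n := by exact_mod_cast hn
  have hδn : 0 < (n : ℝ) ^ (-α) := Real.rpow_pos_of_pos hn' _
  have hterm : ∀ i i' : ℤ, (∑ᶠ m : ℤ, b m * V ((i - i' + m) * (n : ℝ) ^ (-α))) ^ 2
      = C ^ 2 * ((n : ℝ) ^ (-α)) ^ (4 * (D : ℝ) + 2 * s) * (u (i - i') + (-1 : ℝ) ^ D / C *
          (Rq (i - i') ((n : ℝ) ^ (-α)) (2 * D) r b / ((n : ℝ) ^ (-α)) ^ s)) ^ 2 := by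
    intro i i'
    rw [finsum_eq_sum_of_support_subset (s := Finset.Icc (-(N : ℤ)) N) _
      fun j hj => hS j (left_ne_zero_of_mul hj)]
    have := sq_sum_mul_eq hS (show 2 * D < M + M' by omega) hmomb hV2D hC hs0 hExp hr (i - i') hδn
    rw [Int.cast_sub] at this
    exact this
  simp only [hterm, ← Finset.mul_sum]
  have hp : ((n : ℝ) ^ (-α)) ^ (4 * (D : ℝ) + 2 * s) ≠ 0 := (Real.rpow_pos_of_pos hδn _).ne'
  change _ = _ / (_ * ∑' i, u i ^ 2)
  generalize ∑' i, u i ^ 2 = U at hU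
  have hU0 := hU.ne'
  generalize ((n : ℝ) ^ (-α)) ^ (4 * (D : ℝ) + 2 * s) = W at hp
  generalize ∑ i ∈ Finset.Icc (1 : ℤ) ((n - L + 1 : ℕ) : ℤ), (_ : ℝ) = X
  field_simp
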